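/- Let W > 0, d ≥ 0, and let x ∈ {0,1}^(4^d) satisfy C(x) ≤ W. If x is a 1-instance, then w_+(x, P_{G_d}) ≤ W/2; if x is a 0-instance, then w_-(x, P_{G_d}) ≤ 2W. -/

import Mathlib

open scoped ENNReal
open scoped Classical

namespace NandTree

/-- The bit-`b` half of an input of length `2^(m+1)`: `b = false` gives the first half,
`b = true` the second half (lexicographic indexing, first bit most significant). -/
def halfInput (m : ℕ) (b : Bool) (x : Fin (2^(m+1)) → Bool) : Fin (2^m) → Bool :=
  fun i => x ⟨(cond b 1 0) * 2^m + i.val, by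
    have h := i.isLt
    have h2 : (2:ℕ)^(m+1) = 2^m * 2 := pow_succ 2 m
    cases b <;> simp only [cond_true, cond_false] <;> omega⟩

/-- The value `NAND_ℓ(x)` of a depth-`ℓ` NAND-tree instance: internal nodes at even
distance from the leaves are OR gates, at odd distance AND gates. -/
def nand : (ℓ : ℕ) → (Fin (2^ℓ) → Bool) → Bool
  | 0, x => x ⟨0, by norm_num⟩
  | (ℓ+1), x =>
    if (ℓ+1) % 2 = 0 then
      nand ℓ (halfInput ℓ false x) || nand ℓ (halfInput ℓ true x)
    else
      nand ℓ (halfInput ℓ false x) && nand ℓ (halfInput ℓ true x)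

/-- Index of a leaf given by a root-to-leaf bit string (lexicographic, first bit most
significant). -/
def leafIdx (s : List Bool) : ℕ := s.foldl (fun n b => 2 * n + cond b 1 0) 0

/-- The value of the leaf reached by bit string `s` in instance `x`. -/
def leafVal (m : ℕ) (x : Fin (2^m) → Bool) (s : List Bool) : Bool :=
  if h : leafIdx s < 2^m then x ⟨leafIdx s, h⟩ else false

/-- The root-to-leaf path determined by strategies `σA`, `σB` (each assigning a choice of
child to every node, nodes being given by the list of choices from the root): at a node
at distance `m+1` from the leaves, Player A chooses a child if `m+1` is even, else
Player B chooses. -/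
def gamePath (σA σB : List Bool → Bool) : (m : ℕ) → List Bool → List Bool
  | 0, p => p
  | (m+1), p => gamePath σA σB m (p ++ [if (m+1) % 2 = 0 then σA p else σB p])

/-- `winning Z m x σ`: strategy `σ` is a winning strategy for player `Z` (`true` = A,
`false` = B) in the two-player game on the depth-`m` instance `x`: against every
opponent strategy, the reached leaf has value `Z` (A wins on `1 = true`, B on
`0 = false`). -/
def winning (Z : Bool) (m : ℕ) (x : Fin (2^m) → Bool) (σ : List Bool → Bool) : Prop :=
  ∀ τ : List Bool → Bool,
    leafVal m x (gamePath (if Z then σ else τ) (if Z then τ else σ) m []) = Z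

mutual

/-- The criticality `c(v)` of the root of a depth-`m` subtree with input `y`. -/
noncomputable def crit : (m : ℕ) → (Fin (2^m) → Bool) → ℝ≥0∞
  | 0, _ => 1
  | 1, y => if y ⟨0, by norm_num⟩ = y ⟨1, by norm_num⟩ then 1 else 2
  | (m+2), y =>
    if nand (m+2) y ≠ decide ((m+2) % 2 = 0) then 1
    else if nand (m+1) (halfInput (m+1) false y) ≠ nand (m+1) (halfInput (m+1) true y) then 2
    else
      (max (CZ (decide ((m+2) % 2 = 0)) m (halfInput m false (halfInput (m+1) false y)) +
            CZ (decide ((m+2) % 2 = 0)) m (halfInput m true (halfInput (m+1) false y)))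
           (CZ (decide ((m+2) % 2 = 0)) m (halfInput m false (halfInput (m+1) true y)) +
            CZ (decide ((m+2) % 2 = 0)) m (halfInput m true (halfInput (m+1) true y)))) /
      (((CZ (decide ((m+2) % 2 = 0)) m (halfInput m false (halfInput (m+1) false y)) +
         CZ (decide ((m+2) % 2 = 0)) m (halfInput m true (halfInput (m+1) false y))) +
        ((CZ (decide ((m+2) % 2 = 0)) m (halfInput m false (halfInput (m+1) true y)) +
          CZ (decide ((m+2) % 2 = 0)) m (halfInput m true (halfInput (m+1) true y))))) / 2)
termination_by m _ => (m, 0)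

/-- The expected product, over the random choices of `Z`'s opponent, of the criticalities
of the nodes at which `Z` moves along the path played according to strategy `σ`. -/
noncomputable def pathProd (Z : Bool) :
    (σ : List Bool → Bool) → (m : ℕ) → (Fin (2^m) → Bool) → ℝ≥0∞
  | _, 0, _ => 1
  | σ, (m+1), y =>
    if decide ((m+1) % 2 = 0) = Z then
      crit (m+1) y * pathProd Z (fun q => σ (σ [] :: q)) m (halfInput m (σ []) y)
    else
      (pathProd Z (fun q => σ (false :: q)) m (halfInput m false y) +
       pathProd Z (fun q => σ (true :: q)) m (halfInput m true y)) / 2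
termination_by _ m _ => (m, 1)

/-- The average choice complexity `C_Z` of a depth-`m` instance `y` for player `Z`
(`true` = A, `false` = B): the infimum, over `Z`-winning strategies, of the expected
product of criticalities over the nodes where `Z` moves (and `∞` if `Z` has no winning
strategy, the infimum over the empty set being `⊤`). -/
noncomputable def CZ (Z : Bool) (m : ℕ) (y : Fin (2^m) → Bool) : ℝ≥0∞ :=
  ⨅ σ ∈ {σ : List Bool → Bool | winning Z m y σ}, pathProd Z σ m y
termination_by (m, 2)

end

/-- Edges of the graph `G_d`: `G_0` has a single edge; each edge `e` of `G_d` is replaced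
by four edges `(e, b, c)` in `G_{d+1}`, where `b` selects one of the two length-2 paths
and `c` selects the side (`false`: the `u`-side edge, `true`: the `v`-side edge). -/
def Edg : ℕ → Type
  | 0 => Unit
  | (d+1) => Edg d × Bool × Bool

/-- Vertices of `G_d`: `G_0` has vertices `s = false`, `t = true`; `G_{d+1}` has the
vertices of `G_d` plus one new middle vertex `(e, b)` for each edge `e` of `G_d` and
each of the two length-2 paths `b` replacing it. -/
def Vtx : ℕ → Type
  | 0 => Bool
  | (d+1) => Vtx d ⊕ (Edg d × Bool)

instance edgFintype : (d : ℕ) → Fintype (Edg d)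
  | 0 => inferInstanceAs (Fintype Unit)
  | (d+1) => letI := edgFintype d; inferInstanceAs (Fintype (Edg d × Bool × Bool))

instance edgDecEq : (d : ℕ) → DecidableEq (Edg d)
  | 0 => inferInstanceAs (DecidableEq Unit)
  | (d+1) => letI := edgDecEq d; inferInstanceAs (DecidableEq (Edg d × Bool × Bool))

instance vtxDecEq : (d : ℕ) → DecidableEq (Vtx d)
  | 0 => inferInstanceAs (DecidableEq Bool)
  | (d+1) => letI := edgDecEq d; letI := vtxDecEq d
             inferInstanceAs (DecidableEq (Vtx d ⊕ (Edg d × Bool)))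

/-- The two endpoints of an edge of `G_d`: `ep d e false` is the `u`-end and
`ep d e true` is the `v`-end. -/
def ep : (d : ℕ) → Edg d → Bool → Vtx d
  | 0, _, k => k
  | (d+1), (e, b, c), k =>
    match c, k with
    | false, false => Sum.inl (ep d e false)
    | false, true  => Sum.inr (e, b)
    | true,  false => Sum.inr (e, b)
    | true,  true  => Sum.inl (ep d e true)

/-- The vertex `s` of `G_d`. -/
def sVtx : (d : ℕ) → Vtx d
  | 0 => false
  | (d+1) => Sum.inl (sVtx d)

/-- The vertex `t` of `G_d`. -/
def tVtx : (d : ℕ) → Vtx d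
  | 0 => true
  | (d+1) => Sum.inl (tVtx d)

/-- The label of an edge of `G_d`, a bit string of length `2d`: the edge of `G_0` is
labeled by the empty string, and the four edges replacing an edge labeled `τ` are
labeled `τ00`, `τ01` (the two edges of the first path, `u`- and `v`-side) and
`τ10`, `τ11` (the two edges of the second path). -/
def elabel : (d : ℕ) → Edg d → List Bool
  | 0, _ => []
  | (d+1), (e, b, c) => elabel d e ++ [b, c]

/-- The input bit of `x` associated with edge `e` of `G_d` (bits of `x` indexed by the
edge labels in lexicographic order). -/
def edgeBit (d : ℕ) (x : Fin (2^(2*d)) → Bool) (e : Edg d) : Bool :=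
  leafVal (2*d) x (elabel d e)

/-- The positive witness size `w₊(x, P_{G_d})` of the span program `P_{G_d}`: the least
squared norm of a vector `w`, supported on the directed edges available for input `x`
(both orientations `(e, o)` of each edge `e` of `G_d` with `x`-bit `1`), such that
`A w = |s⟩ - |t⟩` where `A |(e,o)⟩ = |ep e o⟩ - |ep e (!o)⟩`; the infimum over the empty
set being `⊤ = ∞` when no witness exists. -/
noncomputable def posWit (d : ℕ) (x : Fin (2^(2*d)) → Bool) : ℝ≥0∞ :=
  ⨅ w ∈ {w : Edg d × Bool → ℝ |
      (∀ p : Edg d × Bool, w p ≠ 0 → edgeBit d x p.1 = true) ∧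
      (∀ v : Vtx d,
        (∑ p : Edg d × Bool, w p *
          ((if ep d p.1 p.2 = v then (1:ℝ) else 0) - (if ep d p.1 (!p.2) = v then 1 else 0)))
        = (if v = sVtx d then (1:ℝ) else 0) - (if v = tVtx d then 1 else 0))},
    ENNReal.ofReal (∑ p : Edg d × Bool, (w p)^2)

/-- The negative witness size `w₋(x, P_{G_d})` of the span program `P_{G_d}`: the least
value of `‖ω ∘ A‖² = Σ_{(e,o)} (ω(ep e o) - ω(ep e (!o)))²` over linear functionals
`ω : V(G_d) → ℝ` vanishing on `A(H(x))` (i.e. `ω(u) - ω(v) = 0` across every available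
directed edge) with `ω(|s⟩ - |t⟩) = 1`; the infimum over the empty set being `⊤ = ∞`
when no witness exists. -/
noncomputable def negWit (d : ℕ) (x : Fin (2^(2*d)) → Bool) : ℝ≥0∞ :=
  ⨅ ω ∈ {ω : Vtx d → ℝ |
      (∀ p : Edg d × Bool, edgeBit d x p.1 = true →
        ω (ep d p.1 p.2) - ω (ep d p.1 (!p.2)) = 0) ∧
      ω (sVtx d) - ω (tVtx d) = 1},
    ENNReal.ofReal (∑ p : Edg d × Bool, (ω (ep d p.1 p.2) - ω (ep d p.1 (!p.2)))^2)

/-! ### The game -/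

theorem leafIdx_foldl (s : List Bool) (n : ℕ) :
    s.foldl (fun n b => 2 * n + cond b 1 0) n = n * 2 ^ s.length + leafIdx s := by
  induction s generalizing n with
  | nil => simp [leafIdx]
  | cons b s ih =>
    simp only [leafIdx, List.foldl_cons, List.length_cons]
    rw [ih, ih (2 * 0 + cond b 1 0)]
    ring

theorem leafIdx_cons (b : Bool) (s : List Bool) :
    leafIdx (b :: s) = (cond b 1 0) * 2 ^ s.length + leafIdx s := by
  have h := leafIdx_foldl s (2 * 0 + cond b 1 0)
  simpa [leafIdx] using h

theorem leafIdx_lt (s : List Bool) : leafIdx s < 2 ^ s.length := by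
  induction s with
  | nil => simp [leafIdx]
  | cons b s ih =>
    rw [leafIdx_cons, List.length_cons, pow_succ]
    cases b <;> simp only [cond_true, cond_false] <;> omega

theorem leafVal_cons (m : ℕ) (x : Fin (2^(m+1)) → Bool) (b : Bool) (s : List Bool)
    (hs : s.length = m) : leafVal (m+1) x (b :: s) = leafVal m (halfInput m b x) s := by
  have h1 := leafIdx_lt s
  have h2 := leafIdx_lt (b :: s)
  subst hs
  rw [List.length_cons] at h2
  simp only [leafVal, h1, h2, dif_pos, halfInput]
  congr 1
  apply Fin.ext
  exact leafIdx_cons b s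

theorem gamePath_length (σA σB : List Bool → Bool) (m : ℕ) (p : List Bool) :
    (gamePath σA σB m p).length = p.length + m := by
  induction m generalizing p with
  | zero => simp [gamePath]
  | succ m ih => rw [gamePath, ih]; simp; omega

theorem gamePath_cons (σA σB : List Bool → Bool) (m : ℕ) (b : Bool) (p : List Bool) :
    gamePath σA σB m (b :: p) =
      b :: gamePath (fun q => σA (b :: q)) (fun q => σB (b :: q)) m p := by
  induction m generalizing p with
  | zero => simp [gamePath]
  | succ m ih => rw [gamePath, gamePath, ← ih]; simp

theorem play_succ (m : ℕ) (y : Fin (2^(m+1)) → Bool) (σA σB : List Bool → Bool) (b : Bool)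
    (hb : (if (m+1) % 2 = 0 then σA [] else σB []) = b) :
    leafVal (m+1) y (gamePath σA σB (m+1) []) =
      leafVal m (halfInput m b y)
        (gamePath (fun q => σA (b :: q)) (fun q => σB (b :: q)) m []) := by
  rw [gamePath, hb, List.nil_append, gamePath_cons, leafVal_cons]
  rw [gamePath_length]; simp

theorem winning_mover (Z : Bool) (m : ℕ) (hZ : decide ((m+1) % 2 = 0) = Z)
    (y : Fin (2^(m+1)) → Bool) (σ : List Bool → Bool) :
    winning Z (m+1) y σ ↔ winning Z m (halfInput m (σ []) y) (fun q => σ (σ [] :: q)) := by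
  unfold winning
  constructor
  · intro h τ
    have h1 := h (fun l => τ l.tail)
    rw [play_succ m y _ _ (σ []) (by subst hZ; by_cases h : (m+1) % 2 = 0 <;> simp [h])] at h1
    cases Z <;> simpa using h1
  · intro h τ
    have h1 := h (fun l => τ (σ [] :: l))
    rw [play_succ m y _ _ (σ []) (by subst hZ; by_cases h : (m+1) % 2 = 0 <;> simp [h])]
    cases Z <;> simpa using h1

theorem winning_opp (Z : Bool) (m : ℕ) (hZ : decide ((m+1) % 2 = 0) ≠ Z)
    (y : Fin (2^(m+1)) → Bool) (σ : List Bool → Bool) :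
    winning Z (m+1) y σ ↔ ∀ b, winning Z m (halfInput m b y) (fun q => σ (b :: q)) := by
  have hZ : decide ((m+1) % 2 = 0) = !Z := by
    cases Z <;> simpa using hZ
  unfold winning
  constructor
  · intro h b τ
    have h1 := h (fun l => if l = [] then b else τ l.tail)
    rw [play_succ m y _ _ b (by
      cases Z <;> simp at hZ <;> simp [hZ])] at h1
    cases Z <;> simpa using h1
  · intro h τ
    have h1 := h (τ []) (fun l => τ (τ [] :: l))
    rw [play_succ m y _ _ (τ []) (by
      cases Z <;> simp at hZ <;> simp [hZ])]
    cases Z <;> simpa using h1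

theorem nand_mover (Z : Bool) (m : ℕ) (hZ : decide ((m+1) % 2 = 0) = Z)
    (y : Fin (2^(m+1)) → Bool) :
    nand (m+1) y = Z ↔ ∃ b, nand m (halfInput m b y) = Z := by
  subst hZ
  rw [nand, Bool.exists_bool]
  generalize nand m (halfInput m false y) = p
  generalize nand m (halfInput m true y) = q
  by_cases h : (m+1) % 2 = 0 <;> cases p <;> cases q <;> simp [h]

theorem nand_opp (Z : Bool) (m : ℕ) (hZ : decide ((m+1) % 2 = 0) ≠ Z)
    (y : Fin (2^(m+1)) → Bool) :
    nand (m+1) y = Z ↔ ∀ b, nand m (halfInput m b y) = Z := by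
  rw [nand, Bool.forall_bool]
  generalize nand m (halfInput m false y) = p
  generalize nand m (halfInput m true y) = q
  cases Z <;> simp at hZ <;> cases p <;> cases q <;> simp [hZ]

theorem exists_winning_iff (Z : Bool) (m : ℕ) (y : Fin (2^m) → Bool) :
    (∃ σ, winning Z m y σ) ↔ nand m y = Z := by
  induction m with
  | zero => simp [winning, nand, gamePath, leafVal, leafIdx]
  | succ m ih =>
    by_cases hZ : decide ((m+1) % 2 = 0) = Z
    · rw [nand_mover Z m hZ]
      simp only [← ih, winning_mover Z m hZ]
      constructor
      · rintro ⟨σ, h⟩; exact ⟨_, _, h⟩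
      · rintro ⟨b, σ, h⟩
        exact ⟨fun l => if l = [] then b else σ l.tail, by simpa using h⟩
    · rw [nand_opp Z m hZ]
      simp only [← ih, winning_opp Z m hZ]
      constructor
      · rintro ⟨σ, h⟩ b; exact ⟨_, h b⟩
      · intro h
        choose σ hσ using h
        exact ⟨fun l => σ (l.headD false) l.tail, by simpa using hσ⟩

/-! ### Average choice complexity -/

theorem CZ_top (Z : Bool) (m : ℕ) (y : Fin (2^m) → Bool) (h : nand m y ≠ Z) :
    CZ Z m y = ⊤ := by
  rw [CZ]
  simp only [Set.mem_ofPred_eq, iInf_eq_top]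
  intro σ hσ
  exact absurd ((exists_winning_iff Z m y).1 ⟨σ, hσ⟩) h

theorem ratio_le (a b : ℝ≥0∞) : max a b / ((a + b) / 2) ≤ 2 := by
  apply ENNReal.div_le_of_le_mul
  rw [ENNReal.mul_div_cancel (by simp) (by simp)]
  exact max_le le_self_add le_add_self

theorem crit_le (m : ℕ) (y : Fin (2^m) → Bool) : crit m y ≤ 2 := by
  match m, y with
  | 0, y => rw [crit]; exact one_le_two
  | 1, y => rw [crit]; split_ifs <;> simp
  | m+2, y =>
    rw [crit]
    split_ifs
    · exact one_le_two
    · exact le_rfl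
    · exact ratio_le _ _

theorem pathProd_lt_top (Z : Bool) (σ : List Bool → Bool) (m : ℕ) (y : Fin (2^m) → Bool) :
    pathProd Z σ m y < ⊤ := by
  induction m generalizing σ with
  | zero => rw [pathProd]; simp
  | succ m ih =>
    rw [pathProd]
    split_ifs
    · exact ENNReal.mul_lt_top ((crit_le _ _).trans_lt (by simp)) (ih _ _)
    · exact ENNReal.div_lt_top (ENNReal.add_lt_top.2 ⟨ih _ _, ih _ _⟩).ne (by simp)

theorem CZ_lt_top (Z : Bool) (m : ℕ) (y : Fin (2^m) → Bool) (h : nand m y = Z) :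
    CZ Z m y < ⊤ := by
  obtain ⟨σ, hσ⟩ := (exists_winning_iff Z m y).2 h
  rw [CZ]
  exact (iInf₂_le σ hσ).trans_lt (pathProd_lt_top _ _ _ _)

theorem CZ_zero (Z : Bool) (y : Fin (2^0) → Bool) (h : nand 0 y = Z) : CZ Z 0 y = 1 := by
  obtain ⟨σ, hσ⟩ := (exists_winning_iff Z 0 y).2 h
  rw [CZ]
  simp only [pathProd]
  exact le_antisymm (iInf₂_le σ hσ) (le_iInf₂ fun _ _ => le_rfl)

theorem CZ_le (Z : Bool) (m : ℕ) (y : Fin (2^m) → Bool) (σ : List Bool → Bool)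
    (h : winning Z m y σ) : CZ Z m y ≤ pathProd Z σ m y := by
  rw [CZ]
  exact iInf₂_le σ h

theorem CZ_opp (Z : Bool) (m : ℕ) (hZ : decide ((m+1) % 2 = 0) ≠ Z)
    (y : Fin (2^(m+1)) → Bool) :
    CZ Z (m+1) y = (CZ Z m (halfInput m false y) + CZ Z m (halfInput m true y)) / 2 := by
  apply le_antisymm
  · rw [ENNReal.le_div_iff_mul_le (by simp) (by simp)]
    rw [CZ.eq_1 Z m (halfInput m false y), CZ.eq_1 Z m (halfInput m true y)]
    simp only [ENNReal.iInf_add, ENNReal.add_iInf]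
    refine le_iInf₂ fun σ1 h1 => le_iInf₂ fun σ0 h0 => ?_
    have h := CZ_le Z (m+1) y (fun l => cond (l.headD false) (σ1 l.tail) (σ0 l.tail)) (by
      rw [winning_opp Z m hZ]
      intro b; cases b
      · simpa using h0
      · simpa using h1)
    rw [pathProd, if_neg hZ] at h
    rw [← ENNReal.le_div_iff_mul_le (by simp) (by simp)]
    simpa using h
  · rw [CZ.eq_1 Z (m+1)]
    refine le_iInf₂ fun σ h => ?_
    rw [pathProd, if_neg hZ]
    have h := (winning_opp Z m hZ y σ).1 h
    gcongr
    · exact CZ_le _ _ _ _ (h false)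
    · exact CZ_le _ _ _ _ (h true)

theorem crit_mul_le (Z : Bool) (m : ℕ) (hZ : decide ((m+1) % 2 = 0) = Z)
    (y : Fin (2^(m+1)) → Bool) :
    crit (m+1) y * min (CZ Z m (halfInput m false y)) (CZ Z m (halfInput m true y))
      ≤ CZ Z (m+1) y := by
  rw [CZ.eq_1 Z (m+1)]
  refine le_iInf₂ fun σ h => ?_
  rw [pathProd, if_pos hZ]
  have h := (winning_mover Z m hZ y σ).1 h
  gcongr
  refine le_trans ?_ (CZ_le _ _ _ _ h)
  cases σ []
  · exact min_le_left _ _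
  · exact min_le_right _ _

theorem par_ident (a b : ℝ≥0∞) (ha : a ≠ ⊤) (hb : b ≠ ⊤) :
    2 * (a⁻¹ + b⁻¹)⁻¹ ≤ max a b / ((a + b) / 2) * min a b := by
  by_cases ha0 : a = 0
  · simp [ha0]
  by_cases hb0 : b = 0
  · simp [hb0]
  lift a to NNReal using ha
  lift b to NNReal using hb
  have ha1 : a ≠ 0 := by simpa using ha0
  have hb1 : b ≠ 0 := by simpa using hb0
  have hs : (a + b) / 2 ≠ 0 := by
    have : 0 < a := pos_iff_ne_zero.2 ha1
    positivity
  have hi : a⁻¹ + b⁻¹ ≠ 0 := by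
    have : 0 < a := pos_iff_ne_zero.2 ha1
    positivity
  rw [← ENNReal.coe_inv ha1, ← ENNReal.coe_inv hb1, ← ENNReal.coe_add, ← ENNReal.coe_inv hi]
  have h2 : (2 : ℝ≥0∞) = ((2 : NNReal) : ℝ≥0∞) := rfl
  rw [h2, ← ENNReal.coe_add, ← ENNReal.coe_div (by simp), ← ENNReal.coe_max, ← ENNReal.coe_min,
    ← ENNReal.coe_div hs, ← ENNReal.coe_mul, ← ENNReal.coe_mul, ENNReal.coe_le_coe]
  rw [div_mul_eq_mul_div, max_mul_min]
  apply le_of_eq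
  have : a + b ≠ 0 := by
    have : 0 < a := pos_iff_ne_zero.2 ha1
    positivity
  field_simp
  ring

theorem par_half (a b : ℝ≥0∞) : 2 * ((a / 2)⁻¹ + (b / 2)⁻¹)⁻¹ = (a⁻¹ + b⁻¹)⁻¹ := by
  have h : ∀ a : ℝ≥0∞, (a / 2)⁻¹ = 2 * a⁻¹ := fun a => by
    rw [ENNReal.inv_div (by simp) (by simp), div_eq_mul_inv]
  rw [h, h, ← mul_add, ENNReal.mul_inv (by simp) (by simp), ← mul_assoc,
    ENNReal.mul_inv_cancel (by simp) (by simp), one_mul]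

theorem ratio_half (a b : ℝ≥0∞) :
    max (a / 2) (b / 2) / ((a / 2 + b / 2) / 2) = max a b / ((a + b) / 2) := by
  have h1 : max (a / 2) (b / 2) = max a b / 2 := by
    rcases le_total a b with h | h
    · rw [max_eq_right h, max_eq_right (by gcongr)]
    · rw [max_eq_left h, max_eq_left (by gcongr)]
  rw [h1, ← ENNReal.add_div]
  generalize (a + b) / 2 = Y
  rw [div_eq_mul_inv (max a b) 2, div_eq_mul_inv Y 2, ENNReal.mul_div_mul_right _ _ (by simp) (by simp)]

theorem CZ_mover (Z : Bool) (m : ℕ) (hZ : decide ((m+1) % 2 = 0) = Z)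
    (y : Fin (2^(m+1)) → Bool) :
    2 * ((CZ Z m (halfInput m false y))⁻¹ + (CZ Z m (halfInput m true y))⁻¹)⁻¹
      ≤ CZ Z (m+1) y := by
  by_cases hn : nand (m+1) y = Z
  swap
  · rw [CZ_top _ _ _ hn]; exact le_top
  refine le_trans ?_ (crit_mul_le Z m hZ y)
  by_cases hf : nand m (halfInput m false y) = nand m (halfInput m true y)
  · have hb : ∀ b, nand m (halfInput m b y) = Z := by
      obtain ⟨b, hb⟩ := (nand_mover Z m hZ y).1 hn
      intro c; cases b <;> cases c <;> simp_all
    have hcr : crit (m+1) y = max (CZ Z m (halfInput m false y)) (CZ Z m (halfInput m true y)) /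
        ((CZ Z m (halfInput m false y) + CZ Z m (halfInput m true y)) / 2) := by
      match m, hZ, y, hn, hf, hb with
      | 0, hZ, y, hn, hf, hb =>
        rw [CZ_zero _ _ (hb false), CZ_zero _ _ (hb true), crit, if_pos]
        · have h2 : (1 + 1 : ℝ≥0∞) / 2 = 1 := by
            rw [one_add_one_eq_two]; exact ENNReal.div_self (by simp) (by simp)
          rw [h2]; simp
        · simpa [nand, halfInput] using hf
      | m+1, hZ, y, hn, hf, hb =>
        have hZ' : decide ((m+1) % 2 = 0) ≠ Z := by
          subst hZ
          simp only [ne_eq, decide_eq_decide]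
          omega
        rw [CZ_opp Z m hZ', CZ_opp Z m hZ', ratio_half, crit]
        subst hZ
        rw [if_neg (not_not.2 hn), if_neg (not_not.2 hf)]
    rw [hcr]
    exact par_ident _ _ (CZ_lt_top _ _ _ (hb false)).ne (CZ_lt_top _ _ _ (hb true)).ne
  · have hcr : crit (m+1) y = 2 := by
      match m, hZ, y, hn, hf with
      | 0, hZ, y, hn, hf =>
        rw [crit, if_neg]
        simpa [nand, halfInput] using hf
      | m+1, hZ, y, hn, hf =>
        rw [crit]
        subst hZ
        rw [if_neg (not_not.2 hn), if_pos hf]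
    rw [hcr]
    by_cases h0 : nand m (halfInput m false y) = Z
    · have h1 : nand m (halfInput m true y) ≠ Z := fun h => hf (h0.trans h.symm)
      rw [CZ_top _ _ _ h1]; simp
    · rw [CZ_top _ _ _ h0]; simp

/-! ### Tree recursion on lists -/

/-- Quaternary tree evaluation from the root. -/
noncomputable def tree (P : (Bool → Bool → ℝ≥0∞) → ℝ≥0∞) : ℕ → (List Bool → ℝ≥0∞) → ℝ≥0∞
  | 0, f => f []
  | (d+1), f => P fun b c => tree P d fun s => f (b :: c :: s)

theorem tree_bottom (P : (Bool → Bool → ℝ≥0∞) → ℝ≥0∞) (d : ℕ) (f : List Bool → ℝ≥0∞) :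
    tree P (d+1) f = tree P d fun s => P fun b c => f (s ++ [b, c]) := by
  induction d generalizing f with
  | zero => simp [tree]
  | succ d ih =>
    rw [tree, tree]
    congr 1
    funext b c
    rw [ih]
    simp

theorem tree_congr (P : (Bool → Bool → ℝ≥0∞) → ℝ≥0∞) (d : ℕ) (f g : List Bool → ℝ≥0∞)
    (h : ∀ s, s.length = 2 * d → f s = g s) : tree P d f = tree P d g := by
  induction d generalizing f g with
  | zero => exact h [] rfl
  | succ d ih =>
    rw [tree, tree]
    congr 1
    funext b c
    apply ih
    intro s hs
    apply h
    simp [hs]; ring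

/-- Parallel composition of two series pairs. -/
noncomputable def PA (f : Bool → Bool → ℝ≥0∞) : ℝ≥0∞ :=
  ((f false false + f false true)⁻¹ + (f true false + f true true)⁻¹)⁻¹

/-- The dual composition. -/
noncomputable def PB (f : Bool → Bool → ℝ≥0∞) : ℝ≥0∞ :=
  ((f false false)⁻¹ + (f false true)⁻¹)⁻¹ + ((f true false)⁻¹ + (f true true)⁻¹)⁻¹

/-- Leaf weights. -/
noncomputable def lw (Z : Bool) (m : ℕ) (x : Fin (2^m) → Bool) (s : List Bool) : ℝ≥0∞ :=
  if leafVal m x s = Z then 1 else ⊤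

theorem lw_cons (Z : Bool) (m : ℕ) (x : Fin (2^(m+2)) → Bool) (b c : Bool) (s : List Bool)
    (hs : s.length = m) :
    lw Z (m+2) x (b :: c :: s) = lw Z m (halfInput m c (halfInput (m+1) b x)) s := by
  unfold lw
  rw [leafVal_cons (m+1) _ _ _ (by simp [hs]), leafVal_cons m _ _ _ hs]

theorem tree_base (Z : Bool) (x : Fin (2^0) → Bool) : lw Z 0 x [] ≤ CZ Z 0 x := by
  by_cases h : nand 0 x = Z
  · rw [CZ_zero _ _ h]
    have : leafVal 0 x [] = Z := by simpa [leafVal, leafIdx, nand] using h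
    simp [lw, this]
  · rw [CZ_top _ _ _ h]; exact le_top

theorem treeA_le (d : ℕ) (x : Fin (2^(2*d)) → Bool) :
    tree PA d (lw true (2*d) x) ≤ CZ true (2*d) x := by
  induction d with
  | zero => exact tree_base true x
  | succ d ih =>
    have ih' : ∀ b c, tree PA d (fun s => lw true (2*d+2) x (b :: c :: s)) ≤
        CZ true (2*d) (halfInput (2*d) c (halfInput (2*d+1) b x)) := by
      intro b c
      refine le_trans (le_of_eq ?_) (ih _)
      exact tree_congr _ _ _ _ fun s hs => lw_cons _ _ _ _ _ _ hs
    have h1 := CZ_mover true (2*d+1) (by simp; omega) x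
    have hZ : decide ((2*d+1) % 2 = 0) ≠ true := by simp
    rw [CZ_opp true (2*d) hZ, CZ_opp true (2*d) hZ, par_half] at h1
    refine le_trans ?_ h1
    rw [tree, PA]
    gcongr <;> exact ih' _ _

theorem treeB_le (d : ℕ) (x : Fin (2^(2*d)) → Bool) :
    tree PB d (lw false (2*d) x) ≤ CZ false (2*d) x := by
  induction d with
  | zero => exact tree_base false x
  | succ d ih =>
    have ih' : ∀ b c, tree PB d (fun s => lw false (2*d+2) x (b :: c :: s)) ≤
        CZ false (2*d) (halfInput (2*d) c (halfInput (2*d+1) b x)) := by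
      intro b c
      refine le_trans (le_of_eq ?_) (ih _)
      exact tree_congr _ _ _ _ fun s hs => lw_cons _ _ _ _ _ _ hs
    have h1 := fun y => CZ_mover false (2*d) (by simp) y
    have hZ : decide ((2*d+1+1) % 2 = 0) ≠ false := by simp; omega
    have h2 := CZ_opp false (2*d+1) hZ x
    refine le_trans ?_ h2.ge
    rw [ENNReal.le_div_iff_mul_le (by simp) (by simp), tree, PB, mul_comm, mul_add]
    refine le_trans ?_ (add_le_add (h1 _) (h1 _))
    gcongr <;> exact ih' _ _

/-! ### Splitting -/

theorem split_exists (A B : ℝ≥0∞) (t : ℝ) : ∃ t0 t1 : ℝ, t0 + t1 = t ∧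
    A * ENNReal.ofReal (t0^2) + B * ENNReal.ofReal (t1^2) ≤
      (A⁻¹ + B⁻¹)⁻¹ * ENNReal.ofReal (t^2) := by
  by_cases hA0 : A = 0
  · exact ⟨t, 0, by simp, by simp [hA0]⟩
  by_cases hB0 : B = 0
  · exact ⟨0, t, by simp, by simp [hB0]⟩
  by_cases hA : A = ⊤
  · exact ⟨0, t, by simp, by simp [hA]⟩
  by_cases hB : B = ⊤
  · exact ⟨t, 0, by simp, by simp [hB]⟩
  lift A to NNReal using hA
  lift B to NNReal using hB
  have ha1 : A ≠ 0 := by simpa using hA0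
  have hb1 : B ≠ 0 := by simpa using hB0
  have hap : 0 < A := pos_iff_ne_zero.2 ha1
  have hbp : 0 < B := pos_iff_ne_zero.2 hb1
  have hi : A⁻¹ + B⁻¹ ≠ 0 := by positivity
  have hap' : (0:ℝ) < A := hap
  have hbp' : (0:ℝ) < B := hbp
  refine ⟨t * B / (A + B), t * A / (A + B), by field_simp; ring, ?_⟩
  rw [← ENNReal.coe_inv ha1, ← ENNReal.coe_inv hb1, ← ENNReal.coe_add, ← ENNReal.coe_inv hi]
  rw [← ENNReal.ofReal_coe_nnreal, ← ENNReal.ofReal_coe_nnreal, ← ENNReal.ofReal_coe_nnreal,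
    ← ENNReal.ofReal_mul (by positivity), ← ENNReal.ofReal_mul (by positivity),
    ← ENNReal.ofReal_mul (by positivity), ← ENNReal.ofReal_add (by positivity) (by positivity)]
  apply ENNReal.ofReal_le_ofReal
  apply le_of_eq
  push_cast
  field_simp
  ring

/-! ### Graphs -/

theorem sum_edg_succ {M : Type*} [AddCommMonoid M] (d : ℕ) (f : Edg (d+1) → M) :
    ∑ e, f e = ∑ e : Edg d, ((f (e, false, false) + f (e, false, true)) +
      (f (e, true, false) + f (e, true, true))) := by
  have h : ∀ g : Edg d × Bool × Bool → M, ∑ e, g e =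
      ∑ e : Edg d, ((g (e, false, false) + g (e, false, true)) +
      (g (e, true, false) + g (e, true, true))) := by
    intro g
    rw [Fintype.sum_prod_type]
    refine Finset.sum_congr rfl fun e _ => ?_
    rw [Fintype.sum_prod_type]
    simp only [Fintype.sum_bool]
    rw [add_comm (g (e, false, false)), add_comm (g (e, true, false)), add_comm]
  exact h f

/-- Old vertices in the next graph. -/
def inV (d : ℕ) (u : Vtx d) : Vtx (d+1) := Sum.inl u

/-- New vertices in the next graph. -/
def midV (d : ℕ) (e : Edg d) (b : Bool) : Vtx (d+1) := Sum.inr (e, b)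

theorem inV_inj (d : ℕ) (u v : Vtx d) : inV d u = inV d v ↔ u = v :=
  ⟨fun h => Sum.inl.inj h, fun h => congrArg _ h⟩

theorem inV_ne (d : ℕ) (u : Vtx d) (e : Edg d) (b : Bool) : inV d u ≠ midV d e b :=
  fun h => Sum.inl_ne_inr h

theorem ep_ff (d : ℕ) (e : Edg d) (b : Bool) :
    ep (d+1) (e, b, false) false = inV d (ep d e false) := rfl

theorem ep_ft (d : ℕ) (e : Edg d) (b : Bool) :
    ep (d+1) (e, b, false) true = midV d e b := rfl

theorem ep_tf (d : ℕ) (e : Edg d) (b : Bool) :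
    ep (d+1) (e, b, true) false = midV d e b := rfl

theorem ep_tt (d : ℕ) (e : Edg d) (b : Bool) :
    ep (d+1) (e, b, true) true = inV d (ep d e true) := rfl

theorem vtx_cases (d : ℕ) (v : Vtx (d+1)) : (∃ u, v = inV d u) ∨ ∃ e b, v = midV d e b := by
  rcases v with u | ⟨e, b⟩
  · exact Or.inl ⟨u, rfl⟩
  · exact Or.inr ⟨e, b, rfl⟩

theorem flow_exists (d : ℕ) (r : List Bool → ℝ≥0∞) : ∃ θ : Edg d → ℝ,
    (∀ v : Vtx d, ∑ e, θ e * ((if ep d e false = v then (1:ℝ) else 0) -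
      (if ep d e true = v then 1 else 0)) =
      (if v = sVtx d then (1:ℝ) else 0) - (if v = tVtx d then 1 else 0)) ∧
    ∑ e, r (elabel d e) * ENNReal.ofReal (θ e ^ 2) ≤ tree PA d r := by
  induction d generalizing r with
  | zero =>
    refine ⟨fun _ => 1, ?_, ?_⟩
    · intro v
      have h : ∀ f : Edg 0 → ℝ, ∑ e, f e = f () := fun f => Fintype.sum_unique (ι := Unit) f
      rw [h]
      rw [one_mul]
      congr 1 <;> exact if_congr eq_comm rfl rfl
    · have h : ∀ f : Edg 0 → ℝ≥0∞, ∑ e, f e = f () := fun f => Fintype.sum_unique (ι := Unit) f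
      rw [h]
      simp [tree, elabel]
  | succ d ih =>
    obtain ⟨θ, h1, h2⟩ := ih (fun s => PA fun b c => r (s ++ [b, c]))
    choose t0 t1 ht hE using fun e : Edg d => split_exists
      (r (elabel d e ++ [false, false]) + r (elabel d e ++ [false, true]))
      (r (elabel d e ++ [true, false]) + r (elabel d e ++ [true, true])) (θ e)
    refine ⟨fun e => cond e.2.1 (t1 e.1) (t0 e.1), ?_, ?_⟩
    · intro v
      rw [sum_edg_succ]
      have hs : sVtx (d+1) = inV d (sVtx d) := rfl
      have ht' : tVtx (d+1) = inV d (tVtx d) := rfl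
      rw [hs, ht']
      simp only [ep_ff, ep_ft, ep_tf, ep_tt, cond_true, cond_false]
      rcases vtx_cases d v with ⟨u, rfl⟩ | ⟨e', b, rfl⟩
      · have h1u := h1 u
        simp only [inV_inj, (inV_ne _ _ _ _).symm, if_false]
        rw [← h1u]
        refine Finset.sum_congr rfl fun e _ => ?_
        rw [← ht e]
        ring
      · simp only [inV_ne, (inV_ne _ _ _ _).symm, if_false]
        rw [sub_zero]
        refine Finset.sum_eq_zero fun e _ => ?_
        by_cases hp : midV d e false = midV d e' b <;>
          by_cases hq : midV d e true = midV d e' b <;> simp [hp, hq]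
    · rw [sum_edg_succ, tree_bottom]
      refine le_trans (Finset.sum_le_sum fun e _ => ?_) h2
      simp only [elabel, cond_true, cond_false]
      rw [← add_mul, ← add_mul]
      exact hE e

theorem pot_exists (d : ℕ) (r : List Bool → ℝ≥0∞) : ∃ ω : Vtx d → ℝ,
    ω (sVtx d) - ω (tVtx d) = 1 ∧
    ∑ e, r (elabel d e) * ENNReal.ofReal ((ω (ep d e false) - ω (ep d e true)) ^ 2)
      ≤ tree PB d r := by
  induction d generalizing r with
  | zero =>
    refine ⟨fun v => cond v 0 1, ?_, ?_⟩
    · simp [sVtx, tVtx]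
    · have h : ∀ f : Edg 0 → ℝ≥0∞, ∑ e, f e = f () := fun f => Fintype.sum_unique (ι := Unit) f
      rw [h]
      simp [tree, elabel, ep]
  | succ d ih =>
    obtain ⟨ω, h1, h2⟩ := ih (fun s => PB fun b c => r (s ++ [b, c]))
    choose t0 t1 ht hE using fun (e : Edg d) (b : Bool) => split_exists
      (r (elabel d e ++ [b, false])) (r (elabel d e ++ [b, true]))
      (ω (ep d e false) - ω (ep d e true))
    refine ⟨Sum.elim ω fun p => ω (ep d p.1 false) - t0 p.1 p.2, ?_, ?_⟩
    · simpa [sVtx, tVtx] using h1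
    · rw [sum_edg_succ, tree_bottom]
      refine le_trans (Finset.sum_le_sum fun e _ => ?_) h2
      have h3 : ∀ b, ω (ep d e false) - t0 e b - ω (ep d e true) = t1 e b := fun b => by
        linarith [ht e b]
      simp only [elabel, ep, Sum.elim_inl, Sum.elim_inr, sub_sub_cancel, h3]
      rw [PB, add_mul]
      exact add_le_add (hE e false) (hE e true)

theorem sum_energy (d : ℕ) (Z : Bool) (x : Fin (2^(2*d)) → Bool) (g : Edg d → ℝ) (T : ℝ≥0∞)
    (hT : T ≠ ⊤)
    (h : ∑ e, lw Z (2*d) x (elabel d e) * ENNReal.ofReal (g e ^ 2) ≤ T) :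
    (∀ e, edgeBit d x e ≠ Z → g e = 0) ∧ ENNReal.ofReal (∑ e, g e ^ 2) ≤ T := by
  have h0 : ∀ e, edgeBit d x e ≠ Z → g e = 0 := by
    intro e he
    by_contra hg
    have h1 := (Finset.single_le_sum (f := fun e => lw Z (2*d) x (elabel d e) *
      ENNReal.ofReal (g e ^ 2)) (fun _ _ => zero_le) (Finset.mem_univ e)).trans h
    have h2 : lw Z (2*d) x (elabel d e) = ⊤ := if_neg he
    have h3 : ENNReal.ofReal (g e ^ 2) ≠ 0 := by
      rw [ne_eq, ENNReal.ofReal_eq_zero, not_le]; positivity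
    simp only [h2, ENNReal.top_mul h3, top_le_iff] at h1
    exact hT h1
  refine ⟨h0, ?_⟩
  rw [ENNReal.ofReal_sum_of_nonneg fun _ _ => sq_nonneg _]
  refine le_trans (Finset.sum_le_sum fun e _ => ?_) h
  by_cases he : edgeBit d x e = Z
  · have h2 : lw Z (2*d) x (elabel d e) = 1 := if_pos he
    rw [h2, one_mul]
  · rw [h0 e he]; simp

theorem posWit_le (d : ℕ) (x : Fin (2^(2*d)) → Bool) : posWit d x ≤ CZ true (2*d) x / 2 := by
  by_cases hT : CZ true (2*d) x = ⊤
  · rw [hT, ENNReal.top_div_of_ne_top (by simp)]; exact le_top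
  obtain ⟨θ, h1, h2⟩ := flow_exists d (lw true (2*d) x)
  obtain ⟨h3, h4⟩ := sum_energy d true x θ _ hT (h2.trans (treeA_le d x))
  unfold posWit
  refine (iInf₂_le (fun p => cond p.2 (- (θ p.1) / 2) (θ p.1 / 2)) ⟨?_, ?_⟩).trans ?_
  rotate_left
  · intro p hp
    by_contra hb
    apply hp
    simp [h3 _ hb]
  · intro v
    rw [← h1 v, Fintype.sum_prod_type]
    refine Finset.sum_congr rfl fun e _ => ?_
    simp only [Fintype.sum_bool, cond_true, cond_false, Bool.not_true, Bool.not_false]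
    ring
  · rw [ENNReal.le_div_iff_mul_le (by simp) (by simp)]
    refine le_trans (le_of_eq ?_) h4
    have h5 : (2 : ℝ≥0∞) = ENNReal.ofReal 2 := by simp
    rw [h5, ← ENNReal.ofReal_mul (Finset.sum_nonneg fun _ _ => sq_nonneg _),
      Fintype.sum_prod_type, Finset.sum_mul]
    congr 1
    refine Finset.sum_congr rfl fun e _ => ?_
    simp only [Fintype.sum_bool, cond_true, cond_false]
    ring

theorem negWit_le (d : ℕ) (x : Fin (2^(2*d)) → Bool) : negWit d x ≤ 2 * CZ false (2*d) x := by
  by_cases hT : CZ false (2*d) x = ⊤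
  · rw [hT, ENNReal.mul_top (by simp)]; exact le_top
  obtain ⟨ω, h1, h2⟩ := pot_exists d (lw false (2*d) x)
  obtain ⟨h3, h4⟩ := sum_energy d false x _ _ hT (h2.trans (treeB_le d x))
  unfold negWit
  refine (iInf₂_le ω ⟨?_, h1⟩).trans ?_
  rotate_left
  · rintro ⟨e, o⟩ hp
    have h := h3 e (by simp [show edgeBit d x e = true from hp])
    cases o
    · exact h
    · simp only [Bool.not_true]; linarith
  · refine le_trans (le_of_eq ?_) (mul_le_mul_right h4 2)
    have h5 : (2 : ℝ≥0∞) = ENNReal.ofReal 2 := by simp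
    rw [h5, ← ENNReal.ofReal_mul (by norm_num), Fintype.sum_prod_type, Finset.mul_sum]
    congr 1
    refine Finset.sum_congr rfl fun e _ => ?_
    simp only [Fintype.sum_bool, Bool.not_true, Bool.not_false]
    ring

/-- If `C(x) ≤ W` then `w₊(x, P_{G_d}) ≤ W/2` for `1`-instances and
`w₋(x, P_{G_d}) ≤ 2W` for `0`-instances. -/
theorem witness_bounds_of_avgChoice_le (W : ℝ≥0∞) (hW : 0 < W) (d : ℕ)
    (x : Fin (2^(2*d)) → Bool)
    (hC : min (CZ true (2*d) x) (CZ false (2*d) x) ≤ W) :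
    (nand (2*d) x = true → posWit d x ≤ W / 2) ∧
    (nand (2*d) x = false → negWit d x ≤ 2 * W) := by
  constructor
  · intro h
    rw [CZ_top false (2*d) x (by simp [h]), min_eq_left le_top] at hC
    exact (posWit_le d x).trans (by gcongr)
  · intro h
    rw [CZ_top true (2*d) x (by simp [h]), min_eq_right le_top] at hC
    exact (negWit_le d x).trans (by gcongr)

end NandTree
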